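/- For every integer n ≥ 3 and every real c > 0, the function φ₁(x) = 2x·α''(x) + α'(x) is strictly decreasing on (0,∞), with derivative φ₁'(x) = −6(n−2)(n−1)·c²·x²/(x² + 4(n−1)·c·x)^{5/2} < 0 for x > 0, and φ₁(x) tends to 1/(n−1) as x → ∞; consequently 1/(n−1) < 2x·α''(x) + α'(x) < 3/(n+2) for all x > x₀. -/

import Mathlib

open Real Filter

noncomputable def alphaF (n : ℕ) (c : ℝ) (x : ℝ) : ℝ :=
  (n : ℝ) * c + ((n : ℝ) / (2 * ((n : ℝ) - 1))) * x
    - (((n : ℝ) - 2) / (2 * ((n : ℝ) - 1))) * Real.sqrt (x ^ 2 + 4 * ((n : ℝ) - 1) * c * x)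

noncomputable def yn (n : ℕ) : ℝ :=
  4 * (1 - (n : ℝ)) + (2 * ((n : ℝ) ^ 2 - 4) / Real.sqrt (2 * (n : ℝ) - 5)) *
    Real.cos ((1 / 3) * Real.arctan (((n : ℝ) ^ 2 - 4 * (n : ℝ) + 6) /
      (2 * ((n : ℝ) - 1) * Real.sqrt (2 * (n : ℝ) - 5))))

noncomputable def x0 (n : ℕ) (c : ℝ) : ℝ := yn n * c

noncomputable def betaF (n : ℕ) (c : ℝ) (x : ℝ) : ℝ :=
  alphaF n c (x0 n c) + deriv (alphaF n c) (x0 n c) * (x - x0 n c)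
    + (1 / 2) * deriv (deriv (alphaF n c)) (x0 n c) * (x - x0 n c) ^ 2

noncomputable def gammaF (n : ℕ) (c : ℝ) (x : ℝ) : ℝ :=
  if x0 n c ≤ x then alphaF n c x else betaF n c x

noncomputable def gammaF' (n : ℕ) (c : ℝ) (x : ℝ) : ℝ :=
  derivWithin (gammaF n c) (Set.Ici 0) x

noncomputable def gammaF'' (n : ℕ) (c : ℝ) (x : ℝ) : ℝ :=
  derivWithin (gammaF' n c) (Set.Ici 0) x

noncomputable def omegaF (n : ℕ) (c : ℝ) (x : ℝ) : ℝ :=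
  (x ^ 2 / Real.sqrt (x ^ 2 + 4 * ((n : ℝ) - 1) * c * x)) *
    ((1 + (n : ℝ) ^ 2 * c / x) *
      (((n : ℝ) / ((n : ℝ) - 2) - (1 + 4 * ((n : ℝ) - 1) * c / x) ^ (-(1 / 2) : ℝ)) /
       ((n : ℝ) / ((n : ℝ) - 2) + (1 + 4 * ((n : ℝ) - 1) * c / x) ^ (-(1 / 2) : ℝ)))) ^ 2

theorem hasDerivAt_sqrt_sq_add_mul {b x : ℝ} (hb : 0 < b) (hx : 0 < x) :
    HasDerivAt (fun x => √(x ^ 2 + b * x)) ((x + b / 2) / √(x ^ 2 + b * x)) x := by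
  have hR : 0 < x ^ 2 + b * x := by positivity
  have h : HasDerivAt (fun x : ℝ => x ^ 2 + b * x) (2 * x + b) x := by
    simpa using (hasDerivAt_pow 2 x).fun_add ((hasDerivAt_id' x).const_mul b)
  convert h.sqrt hR.ne' using 1
  have := (Real.sqrt_pos.2 hR).ne'
  field_simp

theorem hasDerivAt_add_div_sqrt_sq_add_mul {b x : ℝ} (hb : 0 < b) (hx : 0 < x) :
    HasDerivAt (fun x => (x + b / 2) / √(x ^ 2 + b * x))
      (-(b ^ 2 / 4) / ((x ^ 2 + b * x) * √(x ^ 2 + b * x))) x := by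
  have hR : 0 < x ^ 2 + b * x := by positivity
  have hs := Real.sqrt_pos.2 hR
  have hs2 := Real.sq_sqrt hR.le
  refine (((hasDerivAt_id' x).add_const (b / 2)).fun_div (hasDerivAt_sqrt_sq_add_mul hb hx)
    hs.ne').congr_deriv (Eq.symm ?_)
  set s := √(x ^ 2 + b * x)
  rw [← hs2]
  field_simp
  rw [hs2]
  ring

/-- The ratio `√x (x + 3b/2) / (x + b)^(3/2)`, written over `x ^ 2 + b * x`. -/
noncomputable def cubicRatio (b x : ℝ) : ℝ :=
  x ^ 2 * (x + 3 * b / 2) / ((x ^ 2 + b * x) * √(x ^ 2 + b * x))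

theorem hasDerivAt_cubicRatio {b x : ℝ} (hb : 0 < b) (hx : 0 < x) :
    HasDerivAt (cubicRatio b)
      (3 / 4 * b ^ 2 * x ^ 2 / ((x ^ 2 + b * x) ^ 2 * √(x ^ 2 + b * x))) x := by
  have hR : 0 < x ^ 2 + b * x := by positivity
  have hs := Real.sqrt_pos.2 hR
  have hs2 := Real.sq_sqrt hR.le
  have h1 : HasDerivAt (fun x : ℝ => x ^ 2 + b * x) (2 * x + b) x := by
    simpa using (hasDerivAt_pow 2 x).fun_add ((hasDerivAt_id' x).const_mul b)
  have h2 : HasDerivAt (fun x : ℝ => x ^ 2 * (x + 3 * b / 2))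
      (2 * x * (x + 3 * b / 2) + x ^ 2) x := by
    simpa using (hasDerivAt_pow 2 x).fun_mul ((hasDerivAt_id' x).add_const (3 * b / 2))
  refine (h2.fun_div (h1.fun_mul (hasDerivAt_sqrt_sq_add_mul hb hx))
    (mul_pos hR hs).ne').congr_deriv (Eq.symm ?_)
  set s := √(x ^ 2 + b * x)
  have e : (2 * x + b) * s + (x ^ 2 + b * x) * ((x + b / 2) / s) = 3 * (x + b / 2) * s := by
    rw [← hs2]
    field_simp
    ring
  rw [e, div_eq_div_iff (by positivity) (by positivity)]
  ring

theorem tendsto_cubicRatio_atTop {b : ℝ} (hb : 0 < b) :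
    Tendsto (cubicRatio b) atTop (nhds 1) := by
  have hdiv (k : ℝ) : Tendsto (fun x : ℝ => 1 + k / x) atTop (nhds 1) := by
    simpa using (tendsto_const_nhds (x := (1 : ℝ))).add (tendsto_id.const_div_atTop k)
  have h := (hdiv (3 * b / 2)).div ((hdiv b).mul (hdiv b).sqrt) (by simp)
  simp only [Real.sqrt_one, mul_one, div_one] at h
  refine h.congr' ?_
  filter_upwards [eventually_gt_atTop 0] with x hx
  have e : √(x ^ 2 + b * x) = x * √(1 + b / x) := by
    rw [show x ^ 2 + b * x = x ^ 2 * (1 + b / x) by field_simp, Real.sqrt_mul (by positivity),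
      Real.sqrt_sq hx.le]
  have : 0 < √(1 + b / x) := Real.sqrt_pos.2 (by positivity)
  simp only [cubicRatio, e, Pi.div_apply]
  field_simp

section

variable {n : ℕ} {c : ℝ}

theorem four_mul_sub_one_mul_pos (hn : 3 ≤ n) (hc : 0 < c) : 0 < 4 * ((n : ℝ) - 1) * c := by
  have : (3 : ℝ) ≤ n := by exact_mod_cast hn
  have : (0 : ℝ) < n - 1 := by linarith
  positivity

theorem hasDerivAt_alphaF (hn : 3 ≤ n) (hc : 0 < c) {x : ℝ} (hx : 0 < x) :
    HasDerivAt (alphaF n c) ((n : ℝ) / (2 * ((n : ℝ) - 1)) - ((n : ℝ) - 2) / (2 * ((n : ℝ) - 1)) *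
      ((x + 4 * ((n : ℝ) - 1) * c / 2) / √(x ^ 2 + 4 * ((n : ℝ) - 1) * c * x))) x := by
  have h := (((hasDerivAt_id x).const_mul ((n : ℝ) / (2 * ((n : ℝ) - 1)))).const_add
    ((n : ℝ) * c)).sub ((hasDerivAt_sqrt_sq_add_mul (four_mul_sub_one_mul_pos hn hc) hx).const_mul
      (((n : ℝ) - 2) / (2 * ((n : ℝ) - 1))))
  rw [mul_one] at h
  exact h

theorem deriv_deriv_alphaF (hn : 3 ≤ n) (hc : 0 < c) {x : ℝ} (hx : 0 < x) :
    deriv (deriv (alphaF n c)) x = ((n : ℝ) - 2) / (2 * ((n : ℝ) - 1)) *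
      ((4 * ((n : ℝ) - 1) * c) ^ 2 / 4 / ((x ^ 2 + 4 * ((n : ℝ) - 1) * c * x) *
        √(x ^ 2 + 4 * ((n : ℝ) - 1) * c * x))) := by
  have h := ((hasDerivAt_add_div_sqrt_sq_add_mul (four_mul_sub_one_mul_pos hn hc) hx).const_mul
    (((n : ℝ) - 2) / (2 * ((n : ℝ) - 1)))).const_sub ((n : ℝ) / (2 * ((n : ℝ) - 1)))
  have e : deriv (alphaF n c) =ᶠ[nhds x] fun x => (n : ℝ) / (2 * ((n : ℝ) - 1)) -
      ((n : ℝ) - 2) / (2 * ((n : ℝ) - 1)) *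
      ((x + 4 * ((n : ℝ) - 1) * c / 2) / √(x ^ 2 + 4 * ((n : ℝ) - 1) * c * x)) := by
    filter_upwards [eventually_gt_nhds hx] with y hy using (hasDerivAt_alphaF hn hc hy).deriv
  rw [e.deriv_eq, h.deriv]
  ring

theorem two_mul_deriv_deriv_alphaF_add_deriv (hn : 3 ≤ n) (hc : 0 < c) {x : ℝ} (hx : 0 < x) :
    2 * x * deriv (deriv (alphaF n c)) x + deriv (alphaF n c) x =
      (n : ℝ) / (2 * ((n : ℝ) - 1)) - ((n : ℝ) - 2) / (2 * ((n : ℝ) - 1)) *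
        cubicRatio (4 * ((n : ℝ) - 1) * c) x := by
  rw [deriv_deriv_alphaF hn hc hx, (hasDerivAt_alphaF hn hc hx).deriv, cubicRatio]
  have hb := four_mul_sub_one_mul_pos hn hc
  generalize 4 * ((n : ℝ) - 1) * c = b at *
  generalize ((n : ℝ) - 2) / (2 * ((n : ℝ) - 1)) = k
  have hR : 0 < x ^ 2 + b * x := by positivity
  have hs := Real.sqrt_pos.2 hR
  generalize √(x ^ 2 + b * x) = s at *
  have e : (x + b / 2) / s = (x + b / 2) * (x ^ 2 + b * x) / ((x ^ 2 + b * x) * s) := by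
    field_simp
  rw [e]
  ring

theorem hasDerivAt_two_mul_deriv_deriv_alphaF_add_deriv (hn : 3 ≤ n) (hc : 0 < c) {x : ℝ}
    (hx : 0 < x) :
    HasDerivAt (fun x => 2 * x * deriv (deriv (alphaF n c)) x + deriv (alphaF n c) x)
      (-6 * ((n : ℝ) - 2) * ((n : ℝ) - 1) * c ^ 2 * x ^ 2 /
        (x ^ 2 + 4 * ((n : ℝ) - 1) * c * x) ^ ((5 : ℝ) / 2)) x := by
  have hb := four_mul_sub_one_mul_pos hn hc
  have hR : 0 < x ^ 2 + 4 * ((n : ℝ) - 1) * c * x := by positivity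
  have h := ((hasDerivAt_cubicRatio hb hx).const_mul
    (((n : ℝ) - 2) / (2 * ((n : ℝ) - 1)))).const_sub ((n : ℝ) / (2 * ((n : ℝ) - 1)))
  have e : (fun x => 2 * x * deriv (deriv (alphaF n c)) x + deriv (alphaF n c) x) =ᶠ[nhds x]
      fun x => (n : ℝ) / (2 * ((n : ℝ) - 1)) - ((n : ℝ) - 2) / (2 * ((n : ℝ) - 1)) *
        cubicRatio (4 * ((n : ℝ) - 1) * c) x := by
    filter_upwards [eventually_gt_nhds hx] with y hy using
      two_mul_deriv_deriv_alphaF_add_deriv hn hc hy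
  refine (h.congr_of_eventuallyEq e).congr_deriv ?_
  have hpow : (x ^ 2 + 4 * ((n : ℝ) - 1) * c * x) ^ ((5 : ℝ) / 2) =
      (x ^ 2 + 4 * ((n : ℝ) - 1) * c * x) ^ 2 * √(x ^ 2 + 4 * ((n : ℝ) - 1) * c * x) := by
    rw [show (5 : ℝ) / 2 = 2 + 1 / 2 by norm_num, Real.rpow_add hR, Real.sqrt_eq_rpow,
      Real.rpow_two]
  rw [hpow]
  have hn' : (3 : ℝ) ≤ n := by exact_mod_cast hn
  have hm : (n : ℝ) - 1 ≠ 0 := by linarith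
  generalize (x ^ 2 + 4 * ((n : ℝ) - 1) * c * x) ^ 2 * √(x ^ 2 + 4 * ((n : ℝ) - 1) * c * x) = D
  field_simp
  ring

theorem neg_six_mul_div_rpow_neg (hn : 3 ≤ n) (hc : 0 < c) {x : ℝ} (hx : 0 < x) :
    -6 * ((n : ℝ) - 2) * ((n : ℝ) - 1) * c ^ 2 * x ^ 2 /
      (x ^ 2 + 4 * ((n : ℝ) - 1) * c * x) ^ ((5 : ℝ) / 2) < 0 := by
  have hb := four_mul_sub_one_mul_pos hn hc
  have hn' : (3 : ℝ) ≤ n := by exact_mod_cast hn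
  have h1 : (0 : ℝ) < n - 1 := by linarith
  have h2 : (0 : ℝ) < n - 2 := by linarith
  refine div_neg_of_neg_of_pos ?_ (Real.rpow_pos_of_pos (by positivity) _)
  have : 0 < 6 * ((n : ℝ) - 2) * ((n : ℝ) - 1) * c ^ 2 * x ^ 2 := by positivity
  linarith

theorem strictAntiOn_two_mul_deriv_deriv_alphaF_add_deriv (hn : 3 ≤ n) (hc : 0 < c) :
    StrictAntiOn (fun x => 2 * x * deriv (deriv (alphaF n c)) x + deriv (alphaF n c) x)
      (Set.Ioi 0) := by
  refine strictAntiOn_of_deriv_neg (convex_Ioi 0) (fun x hx =>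
    (hasDerivAt_two_mul_deriv_deriv_alphaF_add_deriv hn hc hx).continuousAt.continuousWithinAt)
    fun x hx => ?_
  rw [interior_Ioi] at hx
  rw [(hasDerivAt_two_mul_deriv_deriv_alphaF_add_deriv hn hc hx).deriv]
  exact neg_six_mul_div_rpow_neg hn hc hx

theorem tendsto_two_mul_deriv_deriv_alphaF_add_deriv (hn : 3 ≤ n) (hc : 0 < c) :
    Tendsto (fun x => 2 * x * deriv (deriv (alphaF n c)) x + deriv (alphaF n c) x)
      atTop (nhds (1 / ((n : ℝ) - 1))) := by
  have hn' : (3 : ℝ) ≤ n := by exact_mod_cast hn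
  have hm : (n : ℝ) - 1 ≠ 0 := by linarith
  have h := ((tendsto_cubicRatio_atTop (four_mul_sub_one_mul_pos hn hc)).const_mul
    (((n : ℝ) - 2) / (2 * ((n : ℝ) - 1)))).const_sub ((n : ℝ) / (2 * ((n : ℝ) - 1)))
  rw [show (n : ℝ) / (2 * ((n : ℝ) - 1)) - ((n : ℝ) - 2) / (2 * ((n : ℝ) - 1)) * 1 =
    1 / ((n : ℝ) - 1) by field_simp; ring] at h
  refine h.congr' ?_
  filter_upwards [eventually_gt_atTop 0] with x hx
  exact (two_mul_deriv_deriv_alphaF_add_deriv hn hc hx).symm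

theorem cos_arctan_eq_of_three_le {r : ℝ} (hr : 3 ≤ r) :
    cos (arctan ((r ^ 2 - 4 * r + 6) / (2 * (r - 1) * √(2 * r - 5)))) =
      2 * (r - 1) * √(2 * r - 5) / (r ^ 2 - 4) := by
  have hs : 0 < √(2 * r - 5) := Real.sqrt_pos.2 (by linarith)
  have hs2 : √(2 * r - 5) ^ 2 = 2 * r - 5 := Real.sq_sqrt (by linarith)
  have hm : 0 < r - 1 := by linarith
  have hp : 0 < r ^ 2 - 4 := by nlinarith
  generalize √(2 * r - 5) = s at *
  have e : 1 + ((r ^ 2 - 4 * r + 6) / (2 * (r - 1) * s)) ^ 2 =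
      ((r ^ 2 - 4) / (2 * (r - 1) * s)) ^ 2 := by
    field_simp
    rw [hs2]
    ring
  rw [Real.cos_arctan, e, Real.sqrt_sq (by positivity), one_div_div]

theorem yn_pos_and_cubic (hn : 3 ≤ n) :
    0 < yn n ∧ yn n * (yn n + 6 * ((n : ℝ) - 1)) ^ 2 * ((n : ℝ) ^ 2 - 4) ^ 2 =
      ((n : ℝ) ^ 2 - 4 * n + 6) ^ 2 * (yn n + 4 * ((n : ℝ) - 1)) ^ 3 := by
  have hr : (3 : ℝ) ≤ n := by exact_mod_cast hn
  have hcos := cos_arctan_eq_of_three_le hr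
  unfold yn
  generalize (n : ℝ) = r at *
  have hs : 0 < √(2 * r - 5) := Real.sqrt_pos.2 (by linarith)
  have hs2 : √(2 * r - 5) ^ 2 = 2 * r - 5 := Real.sq_sqrt (by linarith)
  have hm : 0 < r - 1 := by linarith
  have hp : 0 < r ^ 2 - 4 := by nlinarith
  have hq : 0 < r ^ 2 - 4 * r + 6 := by nlinarith [sq_nonneg (r - 2)]
  set s := √(2 * r - 5)
  set ψ := arctan ((r ^ 2 - 4 * r + 6) / (2 * (r - 1) * s)) with hψ
  have hC : 0 < cos (1 / 3 * ψ) := by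
    apply Real.cos_pos_of_mem_Ioo
    have h1 := Real.neg_pi_div_two_lt_arctan ((r ^ 2 - 4 * r + 6) / (2 * (r - 1) * s))
    have h2 := Real.arctan_lt_pi_div_two ((r ^ 2 - 4 * r + 6) / (2 * (r - 1) * s))
    rw [← hψ] at h1 h2
    constructor <;> linarith [Real.pi_pos]
  have h3 := Real.cos_three_mul (1 / 3 * ψ)
  rw [show 3 * (1 / 3 * ψ) = ψ by ring, hcos] at h3
  generalize cos (1 / 3 * ψ) = C at *
  obtain ⟨t, ht⟩ : ∃ t, t = 2 * (r ^ 2 - 4) / s * C := ⟨_, rfl⟩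
  rw [← ht]
  have htpos : 0 < t := ht ▸ by positivity
  have hCt : C = t * s / (2 * (r ^ 2 - 4)) := by rw [ht]; field_simp
  have hcub : (2 * r - 5) * t ^ 3 = (3 * t + 4 * (r - 1)) * (r ^ 2 - 4) ^ 2 := by
    rw [hCt] at h3
    field_simp at h3
    rw [← hs2]
    linear_combination -h3 / 4
  have hfac : (4 * (1 - r) + t) * (t + 2 * (r - 1)) ^ 2 * (r ^ 2 - 4) ^ 2 =
      (r ^ 2 - 4 * r + 6) ^ 2 * t ^ 3 := by
    linear_combination 4 * (r - 1) ^ 2 * hcub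
  refine ⟨?_, by linear_combination hfac⟩
  have h5 : 0 < (4 * (1 - r) + t) * ((t + 2 * (r - 1)) ^ 2 * (r ^ 2 - 4) ^ 2) := by
    rw [← mul_assoc, hfac]
    positivity
  exact pos_of_mul_pos_left h5 (by positivity)

theorem x0_pos (hn : 3 ≤ n) (hc : 0 < c) : 0 < x0 n c :=
  mul_pos (yn_pos_and_cubic hn).1 hc

theorem cubicRatio_x0 (hn : 3 ≤ n) (hc : 0 < c) :
    cubicRatio (4 * ((n : ℝ) - 1) * c) (x0 n c) =
      ((n : ℝ) ^ 2 - 4 * n + 6) / ((n : ℝ) ^ 2 - 4) := by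
  obtain ⟨hy, hcub⟩ := yn_pos_and_cubic hn
  have hr : (3 : ℝ) ≤ n := by exact_mod_cast hn
  have hx := x0_pos hn hc
  have hb := four_mul_sub_one_mul_pos hn hc
  have hm : 0 < (n : ℝ) - 1 := by linarith
  have hp : 0 < (n : ℝ) ^ 2 - 4 := by nlinarith
  have hq : 0 < (n : ℝ) ^ 2 - 4 * n + 6 := by nlinarith [sq_nonneg ((n : ℝ) - 2)]
  have hR : 0 < x0 n c ^ 2 + 4 * ((n : ℝ) - 1) * c * x0 n c := by positivity
  have hs2 := Real.sq_sqrt hR.le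
  have hpos : 0 ≤ cubicRatio (4 * ((n : ℝ) - 1) * c) (x0 n c) := by
    unfold cubicRatio
    positivity
  rw [← sq_eq_sq₀ hpos (by positivity), cubicRatio, div_pow, div_pow, mul_pow _ (√_), hs2,
    div_eq_div_iff (by positivity) (by positivity)]
  simp only [x0]
  generalize (n : ℝ) = r at *
  linear_combination yn n ^ 3 * c ^ 6 * hcub

theorem two_mul_deriv_deriv_alphaF_add_deriv_x0 (hn : 3 ≤ n) (hc : 0 < c) :
    2 * x0 n c * deriv (deriv (alphaF n c)) (x0 n c) + deriv (alphaF n c) (x0 n c) =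
      3 / ((n : ℝ) + 2) := by
  have hr : (3 : ℝ) ≤ n := by exact_mod_cast hn
  rw [two_mul_deriv_deriv_alphaF_add_deriv hn hc (x0_pos hn hc), cubicRatio_x0 hn hc]
  have h1 : (n : ℝ) - 1 ≠ 0 := by linarith
  have h2 : (n : ℝ) - 2 ≠ 0 := by linarith
  have h3 : (n : ℝ) + 2 ≠ 0 := by linarith
  rw [show (n : ℝ) ^ 2 - 4 = (n - 2) * (n + 2) by ring]
  field_simp
  ring

end

theorem stmt_19 (n : ℕ) (hn : 3 ≤ n) (c : ℝ) (hc : 0 < c) :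
    StrictAntiOn (fun x => 2 * x * deriv (deriv (alphaF n c)) x + deriv (alphaF n c) x)
      (Set.Ioi 0) ∧
    (∀ x : ℝ, 0 < x →
      HasDerivAt (fun x => 2 * x * deriv (deriv (alphaF n c)) x + deriv (alphaF n c) x)
        (-6 * ((n : ℝ) - 2) * ((n : ℝ) - 1) * c ^ 2 * x ^ 2 /
          (x ^ 2 + 4 * ((n : ℝ) - 1) * c * x) ^ ((5 : ℝ) / 2)) x ∧
      -6 * ((n : ℝ) - 2) * ((n : ℝ) - 1) * c ^ 2 * x ^ 2 /
          (x ^ 2 + 4 * ((n : ℝ) - 1) * c * x) ^ ((5 : ℝ) / 2) < 0) ∧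
    Filter.Tendsto (fun x => 2 * x * deriv (deriv (alphaF n c)) x + deriv (alphaF n c) x)
      Filter.atTop (nhds (1 / ((n : ℝ) - 1))) ∧
    ∀ x : ℝ, x0 n c < x →
      1 / ((n : ℝ) - 1) < 2 * x * deriv (deriv (alphaF n c)) x + deriv (alphaF n c) x ∧
      2 * x * deriv (deriv (alphaF n c)) x + deriv (alphaF n c) x < 3 / ((n : ℝ) + 2) := by
  have hanti := strictAntiOn_two_mul_deriv_deriv_alphaF_add_deriv hn hc
  have hlim := tendsto_two_mul_deriv_deriv_alphaF_add_deriv hn hc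
  refine ⟨hanti, fun x hx => ⟨hasDerivAt_two_mul_deriv_deriv_alphaF_add_deriv hn hc hx,
    neg_six_mul_div_rpow_neg hn hc hx⟩, hlim, fun x hx => ?_⟩
  have h0 := x0_pos hn hc
  have hx' : 0 < x := h0.trans hx
  constructor
  · have hx1 : 0 < x + 1 := by linarith
    refine lt_of_le_of_lt (le_of_tendsto hlim ?_) (hanti hx' hx1 (lt_add_one x))
    filter_upwards [eventually_ge_atTop (x + 1)] with y hy
    exact hanti.antitoneOn hx1 (hx1.trans_le hy) hy
  · rw [← two_mul_deriv_deriv_alphaF_add_deriv_x0 hn hc]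
    exact hanti h0 hx' hx
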